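/- Let R be a commutative ring, N ∈ R, and let u₀, u₁, u₀′, u₁′ ∈ R² be such that the determinant of the 2×2 matrix with columns u₀, u₁ is a unit of R. Then the following are equivalent: (1) there exists a 2×2 matrix L over R with det L = 1, with every entry of L − I divisible by N (I the identity matrix), and with L·u₀ = u₀′ and L·u₁ = u₁′; (2) det(u₀′ | u₁′) = det(u₀ | u₁) and every coordinate of u₀′ − u₀ and of u₁′ − u₁ is divisible by N. -/

import Mathlib

theorem Matrix.mul_transpose_of_pair {R : Type*} [CommRing R] (L : Matrix (Fin 2) (Fin 2) R)
    (u v : Fin 2 → R) :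
    L * (Matrix.of ![u, v]).transpose = (Matrix.of ![L.mulVec u, L.mulVec v]).transpose := by
  ext i j
  fin_cases j <;> rfl

theorem Matrix.dvd_mul_apply_of_dvd_left {R : Type*} [CommRing R] {l m n : Type*} [Fintype m]
    {N : R} {A : Matrix l m R} (hA : ∀ i j, N ∣ A i j) (B : Matrix m n R) (i : l) (j : n) :
    N ∣ (A * B) i j :=
  Finset.dvd_sum fun k _ => (hA i k).mul_right (B k j)

theorem Matrix.dvd_mulVec_sub_apply {R : Type*} [CommRing R] {n : Type*} [Fintype n]
    [DecidableEq n] {N : R} {L : Matrix n n R} (hL : ∀ i j, N ∣ (L - 1) i j) (u : n → R) (i : n) :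
    N ∣ L.mulVec u i - u i := by
  have h : N ∣ (L - 1).mulVec u i := Finset.dvd_sum fun k _ => (hL i k).mul_right (u k)
  rwa [Matrix.sub_mulVec, Matrix.one_mulVec] at h

/-- Let `R` be a commutative ring, `N ∈ R`, and `u₀, u₁, u₀', u₁' ∈ R²` with
the determinant of the matrix with columns `u₀, u₁` a unit.  Then there exists a 2×2 matrix
`L` over `R` with `det L = 1`, all entries of `L - I` divisible by `N`, `L·u₀ = u₀'` and
`L·u₁ = u₁'`, if and only if `det(u₀' | u₁') = det(u₀ | u₁)` and every coordinate of
`u₀' - u₀` and of `u₁' - u₁` is divisible by `N`. -/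
theorem sl2_congruence_transitivity_criterion
    (R : Type) [CommRing R] (N : R) (u₀ u₁ u₀' u₁' : Fin 2 → R)
    (hdet : IsUnit ((Matrix.of ![u₀, u₁]).transpose.det)) :
    (∃ L : Matrix (Fin 2) (Fin 2) R, L.det = 1 ∧ (∀ i j, N ∣ (L - 1) i j) ∧
        L.mulVec u₀ = u₀' ∧ L.mulVec u₁ = u₁') ↔
      ((Matrix.of ![u₀', u₁']).transpose.det = (Matrix.of ![u₀, u₁]).transpose.det ∧
        (∀ i, N ∣ (u₀' i - u₀ i)) ∧ (∀ i, N ∣ (u₁' i - u₁ i))) := by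
  constructor
  · rintro ⟨L, hL, hN, rfl, rfl⟩
    refine ⟨?_, Matrix.dvd_mulVec_sub_apply hN u₀, Matrix.dvd_mulVec_sub_apply hN u₁⟩
    rw [← Matrix.mul_transpose_of_pair, Matrix.det_mul, hL, one_mul]
  · rintro ⟨hd, h₀, h₁⟩
    set U := (Matrix.of ![u₀, u₁]).transpose
    set V := (Matrix.of ![u₀', u₁']).transpose
    have hVU : V * U⁻¹ * U = V := Matrix.nonsing_inv_mul_cancel_right U V hdet
    have hsub : V * U⁻¹ - 1 = (V - U) * U⁻¹ := by
      rw [sub_mul, Matrix.mul_nonsing_inv U hdet]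
    have hcol : (Matrix.of ![(V * U⁻¹).mulVec u₀, (V * U⁻¹).mulVec u₁]).transpose = V := by
      rw [← Matrix.mul_transpose_of_pair, hVU]
    refine ⟨V * U⁻¹, ?_, ?_, funext fun i => congrFun₂ hcol i 0, funext fun i => congrFun₂ hcol i 1⟩
    · rw [Matrix.det_mul, hd, ← Matrix.det_mul, Matrix.mul_nonsing_inv U hdet, Matrix.det_one]
    · rw [hsub]
      refine Matrix.dvd_mul_apply_of_dvd_left (fun i j => ?_) _
      fin_cases j
      exacts [h₀ i, h₁ i]
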